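/- Let p ≥ 3 be a prime, let b ≥ 0 be an integer, and let ε be an integer with 0 ≤ ε ≤ p − 1. Then (−1)^ε · C((b+1)p − 1, bp + ε) ≡ 1 − (b+1)·p·H_ε mod p², as rational numbers. -/

import Mathlib

/-- Congruence of rational numbers modulo `p^k`. -/
def RatCong (p k : ℕ) (x y : ℚ) : Prop :=
  x = y ∨ (k : ℤ) ≤ padicValRat p (x - y)

/-- `z` is `p`-integral. -/
def PInt (p : ℕ) (z : ℚ) : Prop := ∃ n d : ℤ, ¬ (p : ℤ) ∣ d ∧ z * d = n

lemma PInt.int (p : ℕ) (hp : p.Prime) (n : ℤ) : PInt p n :=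
  ⟨n, 1, fun h => hp.one_lt.ne' (by simpa using Int.natAbs_dvd_natAbs.mpr h), by simp⟩

lemma PInt.add {p : ℕ} (hp : p.Prime) {x y : ℚ} (hx : PInt p x) (hy : PInt p y) :
    PInt p (x + y) := by
  obtain ⟨n, d, hd, h⟩ := hx
  obtain ⟨m, e, he, h'⟩ := hy
  refine ⟨n * e + m * d, d * e, (Nat.prime_iff_prime_int.mp hp).not_dvd_mul hd he, ?_⟩
  push_cast
  rw [← h, ← h']; ring

lemma PInt.mul {p : ℕ} (hp : p.Prime) {x y : ℚ} (hx : PInt p x) (hy : PInt p y) :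
    PInt p (x * y) := by
  obtain ⟨n, d, hd, h⟩ := hx
  obtain ⟨m, e, he, h'⟩ := hy
  refine ⟨n * m, d * e, (Nat.prime_iff_prime_int.mp hp).not_dvd_mul hd he, ?_⟩
  push_cast
  rw [← h, ← h']; ring

lemma PInt.inv {p : ℕ} {d : ℤ} (hd : ¬ (p : ℤ) ∣ d) : PInt p ((d : ℚ)⁻¹) := by
  refine ⟨1, d, hd, ?_⟩
  have : (d : ℚ) ≠ 0 := by
    intro h
    apply hd
    have : d = 0 := by exact_mod_cast h
    simp [this]
  simp [this]

lemma PInt.invNat {p i : ℕ} (h0 : 0 < i) (h1 : i < p) : PInt p ((i : ℚ)⁻¹) := by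
  have := PInt.inv (p := p) (d := (i : ℤ)) (by
    intro h
    have := Nat.le_of_dvd h0 (by exact_mod_cast h)
    omega)
  simpa using this

lemma PInt.sum {p : ℕ} (hp : p.Prime) (n : ℕ) (f : ℕ → ℚ) (h : ∀ i < n, PInt p (f i)) :
    PInt p (∑ i ∈ Finset.range n, f i) := by
  induction n with
  | zero => simpa using PInt.int p hp 0
  | succ n ih =>
    rw [Finset.sum_range_succ]
    exact (ih fun i hi => h i (by omega)).add hp (h n (by omega))

lemma PInt.harmonic {p : ℕ} (hp : p.Prime) {n : ℕ} (h : n < p) : PInt p (harmonic n) :=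
  PInt.sum hp n _ fun i hi => PInt.invNat (by omega) (by omega)

lemma harmonic_pred {p : ℕ} (hp : p.Prime) (hp3 : 3 ≤ p) :
    ∃ z, PInt p z ∧ harmonic (p - 1) = p * z := by
  refine ⟨((2 : ℕ) : ℚ)⁻¹ * ∑ i ∈ Finset.range (p - 1),
    (((i + 1 : ℕ) : ℚ)⁻¹ * ((p - 1 - i : ℕ) : ℚ)⁻¹), ?_, ?_⟩
  · refine (PInt.invNat (by omega) (by omega)).mul hp (PInt.sum hp _ _ fun i hi => ?_)
    exact (PInt.invNat (by omega) (by omega)).mul hp (PInt.invNat (by omega) (by omega))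
  · have h1 : harmonic (p - 1) = ∑ i ∈ Finset.range (p - 1), ((p - 1 - i : ℕ) : ℚ)⁻¹ := by
      unfold harmonic
      rw [← Finset.sum_range_reflect]
      refine Finset.sum_congr rfl fun i hi => ?_
      have := Finset.mem_range.mp hi
      congr 2; omega
    have h2 : harmonic (p - 1) + harmonic (p - 1) = p * ∑ i ∈ Finset.range (p - 1),
        (((i + 1 : ℕ) : ℚ)⁻¹ * ((p - 1 - i : ℕ) : ℚ)⁻¹) := by
      nth_rewrite 2 [h1]
      unfold harmonic
      rw [← Finset.sum_add_distrib, Finset.mul_sum]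
      refine Finset.sum_congr rfl fun i hi => ?_
      have hi := Finset.mem_range.mp hi
      have e : (p : ℚ) = ((i + 1 : ℕ) : ℚ) + ((p - 1 - i : ℕ) : ℚ) := by
        rw [← Nat.cast_add]; congr 1; omega
      have a : ((i + 1 : ℕ) : ℚ) ≠ 0 := by positivity
      have b : ((p - 1 - i : ℕ) : ℚ) ≠ 0 := by
        rw [Nat.cast_ne_zero]; omega
      rw [e]
      generalize ((i + 1 : ℕ) : ℚ) = u at *
      generalize ((p - 1 - i : ℕ) : ℚ) = v at *
      field_simp
      ring
    push_cast at h2 ⊢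
    linarith

lemma main_aux {p : ℕ} (hp : p.Prime) (hp3 : 3 ≤ p) (b : ℕ) (j : ℕ) :
    ∀ ε : ℕ, ε + j = p - 1 → ∃ z, PInt p z ∧
      ((-1 : ℚ) ^ ε * ((((b + 1) * p - 1).choose (b * p + ε)) : ℚ)) -
      (1 - ((b : ℚ) + 1) * (p : ℚ) * harmonic ε) = p ^ 2 * z := by
  induction j with
  | zero =>
    intro ε h
    obtain ⟨z, hz, h'⟩ := harmonic_pred hp hp3
    obtain rfl : ε = p - 1 := by omega
    have e : (b + 1) * p - 1 = b * p + (p - 1) := by rw [add_mul]; omega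
    have ev : Even (p - 1) := by
      rcases hp.even_sub_one (by omega) with h
      exact h
    refine ⟨((b + 1 : ℤ) : ℚ) * z, (PInt.int p hp _).mul hp hz, ?_⟩
    rw [e, Nat.choose_self, ev.neg_one_pow, h']
    push_cast; ring
  | succ j ih =>
    intro ε h
    obtain ⟨z, hz, h'⟩ := ih (ε + 1) (by omega)
    have hc := Nat.choose_succ_right_eq ((b + 1) * p - 1) (b * p + ε)
    have e : (b + 1) * p - 1 - (b * p + ε) = j + 1 := by rw [add_mul]; omega
    rw [e] at hc
    have hc : ((((b + 1) * p - 1).choose (b * p + (ε + 1)) : ℕ) : ℚ) * (b * p + ε + 1) =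
      (((b + 1) * p - 1).choose (b * p + ε) : ℕ) * (j + 1) := by exact_mod_cast hc
    have hpj : (p : ℚ) = ε + j + 2 := by
      have : p = ε + j + 2 := by omega
      exact_mod_cast this
    have hj : ((j + 1 : ℕ) : ℚ)⁻¹ * (j + 1) = 1 := by
      push_cast; field_simp
    have hH := PInt.harmonic hp (n := ε) (by omega)
    have hI : PInt p (((ε + 1 : ℕ) : ℚ)⁻¹) := PInt.invNat (by omega) (by omega)
    have hI' : ((ε + 1 : ℕ) : ℚ)⁻¹ * (ε + 1) = 1 := by
      push_cast; field_simp
    rw [harmonic_succ] at h'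
    generalize harmonic ε = H at *
    generalize ((ε + 1 : ℕ) : ℚ)⁻¹ = I at *
    have hJ : PInt p (((j + 1 : ℕ) : ℚ)⁻¹) := PInt.invNat (by omega) (by omega)
    generalize ((j + 1 : ℕ) : ℚ)⁻¹ = J at *
    generalize ((((b + 1) * p - 1).choose (b * p + (ε + 1)) : ℕ) : ℚ) = C' at *
    generalize ((((b + 1) * p - 1).choose (b * p + ε) : ℕ) : ℚ) = C at *
    refine ⟨J * (((-(b * p + ε + 1) : ℤ) : ℚ) * z + ((b * (b + 1) : ℤ) : ℚ) * (H + I)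
      + ((b + 1 : ℤ) : ℚ) * H), ?_, ?_⟩
    · exact hJ.mul hp ((((PInt.int p hp _).mul hp hz).add hp
        ((PInt.int p hp _).mul hp (hH.add hp hI))).add hp ((PInt.int p hp _).mul hp hH))
    · have hj0 : (j + 1 : ℚ) ≠ 0 := by positivity
      apply mul_right_cancel₀ hj0
      have hjp : (j : ℚ) = p - ε - 2 := by linarith
      have t1 : (-1 : ℚ) ^ ε * C * (j + 1) = (-1) ^ ε * C' * (b * p + ε + 1) := by
        rw [mul_assoc, ← hc]; ring
      have t2 : (-1 : ℚ) ^ ε * C' = -(1 - (b + 1) * p * (H + I) + p ^ 2 * z) := by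
        rw [pow_succ] at h'; linarith
      rw [sub_mul, t1, t2]
      push_cast
      rw [show ∀ X : ℚ, (p : ℚ) ^ 2 * (J * X) * (j + 1) = p ^ 2 * X * (J * (j + 1)) by
        intro X; ring, hj, hjp]
      linear_combination ((b : ℚ) + 1) * p * hI'

theorem sign_mul_choose_mod_p_sq (p : ℕ) (hp : p.Prime) (hp3 : 3 ≤ p)
    (b ε : ℕ) (hε : ε ≤ p - 1) :
    RatCong p 2
      ((-1 : ℚ) ^ ε * ((((b + 1) * p - 1).choose (b * p + ε)) : ℚ))
      (1 - ((b : ℚ) + 1) * (p : ℚ) * harmonic ε) := by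
  obtain ⟨z, ⟨n, d, hd, hz⟩, h⟩ := main_aux hp hp3 b (p - 1 - ε) ε (by omega)
  have := Fact.mk hp
  unfold RatCong
  rw [h]
  by_cases hz0 : z = 0
  · left
    rw [hz0, mul_zero] at h
    exact sub_eq_zero.mp h
  · right
    have hp0 : (p : ℚ) ≠ 0 := by exact_mod_cast hp.ne_zero
    have hd0 : (d : ℚ) ≠ 0 := by
      intro h0
      apply hd
      have : d = 0 := by exact_mod_cast h0
      simp [this]
    have hv := congrArg (padicValRat p) hz
    rw [padicValRat.mul hz0 hd0, padicValRat.of_int, padicValRat.of_int,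
      padicValInt.eq_zero_of_not_dvd hd] at hv
    rw [padicValRat.mul (pow_ne_zero 2 hp0) hz0, padicValRat.pow, padicValRat.self hp.one_lt]
    push_cast at hv ⊢
    omega
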